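/- arXiv:2506.17947 — 4 statements merged into one kernel-verified Lean document; each statement's English description precedes it below -/
import Mathlib

section
/- Let k ≥ 1. Every vector-valued polynomial 𝐩 = (p₁, p₂) on ℝ² whose components are real polynomials in two variables of total degree at most k−1 can be written as 𝐩 = 𝐱 q + curl r, where q is a real polynomial in two variables of total degree at most k−2, r is a real polynomial in two variables of total degree at most k, 𝐱 q denotes the vector field (x·q(x,y), y·q(x,y)), and curl r = (∂r/∂y, −∂r/∂x). (This is the decomposition [ℙ_{k−1}(E)]² = 𝐱 ℙ_{k−2}(E) ⊕ curl ℙ_k(E) underlying the definition of the space 𝒫_{k,ℓ_E}.) -/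
open MvPolynomial

/-- The vector field `𝐱 q = (x·q, y·q)` for a scalar polynomial `q` in two variables. -/
noncomputable def xvec (q : MvPolynomial (Fin 2) ℝ) :
    MvPolynomial (Fin 2) ℝ × MvPolynomial (Fin 2) ℝ :=
  (X 0 * q, X 1 * q)

/-- The curl `(∂r/∂y, −∂r/∂x)` of a scalar polynomial `r` in two variables. -/
noncomputable def curl (r : MvPolynomial (Fin 2) ℝ) :
    MvPolynomial (Fin 2) ℝ × MvPolynomial (Fin 2) ℝ :=
  (pderiv (1 : Fin 2) r, -(pderiv (0 : Fin 2) r))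

/-- The Poincaré decomposition of a homogeneous vector field of degree `n`: Euler's identity gives
`(n + 1) p = 𝐱 (div p) + curl (y p₁ - x p₂)`. -/
theorem exists_eq_xvec_add_curl_of_isHomogeneous {n : ℕ} {a b : MvPolynomial (Fin 2) ℝ}
    (ha : a.IsHomogeneous n) (hb : b.IsHomogeneous n) :
    ∃ q r : MvPolynomial (Fin 2) ℝ, (n = 0 → q = 0) ∧ q.totalDegree ≤ n - 1 ∧
      r.totalDegree ≤ n + 1 ∧ (a, b) = xvec q + curl r := by
  have hc : (C ((n : ℝ) + 1)⁻¹ : MvPolynomial (Fin 2) ℝ) *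
      ((n : MvPolynomial (Fin 2) ℝ) + 1) = 1 := by
    have h : ((n : MvPolynomial (Fin 2) ℝ) + 1) = C ((n : ℝ) + 1) := by simp
    rw [h, ← C_mul, inv_mul_cancel₀ (by positivity), C_1]
  have hea := ha.sum_X_mul_pderiv
  have heb := hb.sum_X_mul_pderiv
  simp only [Fin.sum_univ_two, nsmul_eq_mul] at hea heb
  refine ⟨C ((n : ℝ) + 1)⁻¹ * (pderiv 0 a + pderiv 1 b),
    C ((n : ℝ) + 1)⁻¹ * (X 1 * a - X 0 * b), ?_, ?_, ?_, ?_⟩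
  · rintro rfl
    rw [totalDegree_eq_zero_iff_eq_C.mp (Nat.le_zero.mp ha.totalDegree_le),
      totalDegree_eq_zero_iff_eq_C.mp (Nat.le_zero.mp hb.totalDegree_le)]
    simp
  · exact ((ha.pderiv.add hb.pderiv).C_mul _).totalDegree_le
  · have hx := (isHomogeneous_X ℝ (0 : Fin 2)).mul hb
    have hy := (isHomogeneous_X ℝ (1 : Fin 2)).mul ha
    rw [add_comm n 1]
    exact ((hy.sub hx).C_mul _).totalDegree_le
  · ext1
    · simp only [xvec, curl, Prod.fst_add, pderiv_mul, pderiv_C, map_sub, pderiv_X_self,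
        pderiv_X_of_ne (show (0 : Fin 2) ≠ 1 by decide)]
      linear_combination (-a) * hc - C ((n : ℝ) + 1)⁻¹ * hea
    · simp only [xvec, curl, Prod.snd_add, pderiv_mul, pderiv_C, map_sub, pderiv_X_self,
        pderiv_X_of_ne (show (1 : Fin 2) ≠ 0 by decide)]
      linear_combination (-b) * hc - C ((n : ℝ) + 1)⁻¹ * heb

theorem sum_range_homogeneousComponent_of_totalDegree_lt {σ R : Type*} [CommSemiring R]
    {f : MvPolynomial σ R} {k : ℕ} (h : f.totalDegree < k) :
    ∑ i ∈ Finset.range k, homogeneousComponent i f = f := by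
  conv_rhs => rw [← sum_homogeneousComponent f]
  refine (Finset.sum_subset (Finset.range_mono h) fun i _ hi => ?_).symm
  exact homogeneousComponent_eq_zero _ _ (by simpa using hi)

theorem xvec_sum {ι : Type*} (s : Finset ι) (q : ι → MvPolynomial (Fin 2) ℝ) :
    xvec (∑ i ∈ s, q i) = ∑ i ∈ s, xvec (q i) := by
  ext1 <;> simp [xvec, Prod.fst_sum, Prod.snd_sum, Finset.mul_sum]

theorem curl_sum {ι : Type*} (s : Finset ι) (r : ι → MvPolynomial (Fin 2) ℝ) :
    curl (∑ i ∈ s, r i) = ∑ i ∈ s, curl (r i) := by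
  ext1 <;> simp [curl, Prod.fst_sum, Prod.snd_sum]

/-- Every vector polynomial with components of total degree at most `k−1` decomposes as
`𝐱 q + curl r` with `q ∈ ℙ_{k−2}` (with the convention `ℙ_{−1} = {0}`, encoded by the
disjunction `q = 0 ∨ deg q + 2 ≤ k`) and `r ∈ ℙ_k`. -/
theorem statement0 (k : ℕ) (hk : 1 ≤ k)
    (p : MvPolynomial (Fin 2) ℝ × MvPolynomial (Fin 2) ℝ)
    (hp1 : p.1.totalDegree ≤ k - 1) (hp2 : p.2.totalDegree ≤ k - 1) :
    ∃ q r : MvPolynomial (Fin 2) ℝ,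
      (q = 0 ∨ q.totalDegree + 2 ≤ k) ∧ r.totalDegree ≤ k ∧ p = xvec q + curl r := by
  choose q r hq0 hq hr h using fun n => exists_eq_xvec_add_curl_of_isHomogeneous
    (homogeneousComponent_isHomogeneous n p.1) (homogeneousComponent_isHomogeneous n p.2)
  refine ⟨∑ i ∈ Finset.range k, q i, ∑ i ∈ Finset.range k, r i, ?_, ?_, ?_⟩
  · obtain rfl | hk2 : k = 1 ∨ 2 ≤ k := by omega
    · exact Or.inl (by simp [hq0 0 rfl])
    · have hdeg : (∑ i ∈ Finset.range k, q i).totalDegree ≤ k - 2 :=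
        totalDegree_finsetSum_le fun i hi => (hq i).trans (by
          have := Finset.mem_range.mp hi
          omega)
      exact Or.inr (by omega)
  · exact totalDegree_finsetSum_le fun i hi => (hr i).trans (Finset.mem_range.mp hi)
  · rw [xvec_sum, curl_sum, ← Finset.sum_add_distrib, ← Finset.sum_congr rfl fun i _ => h i]
    ext1
    · rw [Prod.fst_sum, sum_range_homogeneousComponent_of_totalDegree_lt (by omega)]
    · rw [Prod.snd_sum, sum_range_homogeneousComponent_of_totalDegree_lt (by omega)]
end

section
/- Let q and r be real polynomials in two variables. If 𝐱 q + curl r = 0 as a polynomial vector field on ℝ² (i.e. x·q + ∂r/∂y = 0 and y·q − ∂r/∂x = 0 identically), then q = 0 and r is a constant polynomial. In particular, the sum 𝐱 ℙ_{k−2} + curl ℙ_{k+ℓ} in the definition of the space 𝒫_{k,ℓ} is direct (modulo constants in the curl argument). -/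
open MvPolynomial

/-- Over a domain of characteristic zero, a polynomial whose partial derivatives all vanish is
constant. -/
theorem eq_C_of_pderiv_eq_zero {σ R : Type*} [CommRing R] [IsDomain R] [CharZero R]
    {p : MvPolynomial σ R} (h : ∀ i, pderiv i p = 0) : p = C (coeff 0 p) := by
  classical
  ext m
  rw [coeff_C]
  split_ifs with hm
  · rw [hm]
  · obtain ⟨i, hi⟩ : ∃ i, m i ≠ 0 := by
      by_contra! H
      exact hm (Finsupp.ext fun i => (H i).symm)
    have hle : Finsupp.single i 1 ≤ m :=
      Finsupp.single_le_iff.mpr (Nat.one_le_iff_ne_zero.mpr hi)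
    have hc := coeff_pderiv (i := i) p (m - Finsupp.single i 1)
    rw [h i, tsub_add_cancel_of_le hle, coeff_zero] at hc
    exact (mul_eq_zero.mp hc.symm).resolve_right (Nat.cast_add_one_ne_zero _)

/-- If `𝐱 q + curl r = 0` identically, then `q = 0` and `r` is a constant polynomial:
the sum `𝐱 ℙ_{k−2} + curl ℙ_{k+ℓ}` is direct (modulo constants in the curl argument). -/
theorem statement1 (q r : MvPolynomial (Fin 2) ℝ)
    (h : xvec q + curl r = 0) :
    q = 0 ∧ ∃ c : ℝ, r = C c := by
  have hx : X 0 * q + pderiv 1 r = 0 := congrArg Prod.fst h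
  have hy : X 1 * q + -pderiv 0 r = 0 := congrArg Prod.snd h
  have hq : q = 0 := by
    ext m
    have h0 := congrArg (coeff (Finsupp.single 0 1 + m)) hx
    have h1 := congrArg (coeff (Finsupp.single 1 1 + m)) hy
    simp only [coeff_add, coeff_neg, coeff_X_mul, coeff_pderiv, coeff_zero] at h0 h1 ⊢
    rw [show Finsupp.single (1 : Fin 2) 1 + m + Finsupp.single 0 1 =
      Finsupp.single 0 1 + m + Finsupp.single 1 1 by abel] at h1
    simp at h0 h1
    set a := coeff (Finsupp.single 0 1 + m + Finsupp.single 1 1) r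
    have ha : a * ((m 0 : ℝ) + m 1 + 2) = 0 := by linear_combination h0 - h1
    have ha0 : a = 0 := (mul_eq_zero.mp ha).resolve_right (by positivity)
    simpa [ha0] using h0
  subst hq
  refine ⟨rfl, coeff 0 r, eq_C_of_pderiv_eq_zero fun i => ?_⟩
  fin_cases i
  · simpa using hy
  · simpa using hx
end

section
/- Let k ≥ 1 and ℓ ≥ 0. The following two subspaces of polynomial vector fields on ℝ² are equal: (i) the sum of [ℙ_{k−1}]² (pairs of polynomials of total degree at most k−1) and {curl r : r ∈ ℙ_{k+ℓ}}, and (ii) the sum of {𝐱 q : q ∈ ℙ_{k−2}} and {curl r : r ∈ ℙ_{k+ℓ}}. (This is the identity 𝒫_{k,ℓ} = [ℙ_{k−1}]² ⊕ curl(ℙ_{k+ℓ}\ℙ_k) = 𝐱 ℙ_{k−2} ⊕ curl ℙ_{k+ℓ} defining the enhanced projection space.) -/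
open MvPolynomial

theorem xvec_add (p q : MvPolynomial (Fin 2) ℝ) : xvec (p + q) = xvec p + xvec q := by
  simp [xvec, mul_add]

theorem curl_add (p q : MvPolynomial (Fin 2) ℝ) : curl (p + q) = curl p + curl q := by
  simp [curl, add_comm]

/-- Homogeneous case of the decomposition: `(a, b)` is `𝐱 (div (a, b)) + curl (y a - x b)` up to
the factor `m + 1`. -/
theorem exists_xvec_add_curl_of_isHomogeneous {k m : ℕ} (hm : m < k)
    {a b : MvPolynomial (Fin 2) ℝ} (ha : a.IsHomogeneous m) (hb : b.IsHomogeneous m) :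
    ∃ q r : MvPolynomial (Fin 2) ℝ, (q = 0 ∨ q.totalDegree + 2 ≤ k) ∧ r.totalDegree ≤ k ∧
      (a, b) = xvec q + curl r := by
  have hc : (C ((m : ℝ) + 1)⁻¹ : MvPolynomial (Fin 2) ℝ) * (m + 1) = 1 := by
    have h : (m : MvPolynomial (Fin 2) ℝ) + 1 = C ((m : ℝ) + 1) := by simp
    rw [h, ← C_mul, inv_mul_cancel₀ (by positivity), C_1]
  refine ⟨C ((m : ℝ) + 1)⁻¹ * (pderiv 0 a + pderiv 1 b),
    C ((m : ℝ) + 1)⁻¹ * (X 1 * a - X 0 * b), ?_, ?_, ?_⟩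
  · rcases Nat.eq_zero_or_pos m with rfl | hpos
    · left
      rw [totalDegree_eq_zero_iff_eq_C.mp (Nat.le_zero.mp ha.totalDegree_le),
        totalDegree_eq_zero_iff_eq_C.mp (Nat.le_zero.mp hb.totalDegree_le)]
      simp
    · right
      have h := (((isHomogeneous_C (Fin 2) ((m : ℝ) + 1)⁻¹).mul
        (ha.pderiv (i := 0) |>.add (hb.pderiv (i := 1))))).totalDegree_le
      omega
  · have h := ((isHomogeneous_C (Fin 2) ((m : ℝ) + 1)⁻¹).mul
      (((isHomogeneous_X ℝ (1 : Fin 2)).mul ha).sub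
        ((isHomogeneous_X ℝ (0 : Fin 2)).mul hb))).totalDegree_le
    omega
  · have hea := ha.sum_X_mul_pderiv
    have heb := hb.sum_X_mul_pderiv
    simp only [Fin.sum_univ_two, nsmul_eq_mul] at hea heb
    ext1
    · simp [xvec, curl, Derivation.leibniz]
      linear_combination -a * hc - C ((m : ℝ) + 1)⁻¹ * hea
    · simp [xvec, curl, Derivation.leibniz]
      linear_combination -b * hc - C ((m : ℝ) + 1)⁻¹ * heb

theorem exists_xvec_add_curl {k : ℕ} {a b : MvPolynomial (Fin 2) ℝ}
    (ha : a.totalDegree < k) (hb : b.totalDegree < k) :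
    ∃ q r : MvPolynomial (Fin 2) ℝ, (q = 0 ∨ q.totalDegree + 2 ≤ k) ∧ r.totalDegree ≤ k ∧
      (a, b) = xvec q + curl r := by
  have hsum {p : MvPolynomial (Fin 2) ℝ} (hp : p.totalDegree < k) :
      ∑ m ∈ Finset.range k, homogeneousComponent m p = p := by
    conv_rhs => rw [← sum_homogeneousComponent p]
    refine (Finset.sum_subset (Finset.range_mono hp) fun m _ h => ?_).symm
    exact homogeneousComponent_eq_zero _ _ (by simpa using h)
  rw [← hsum ha, ← hsum hb, prod_mk_sum]
  refine Finset.sum_induction _ (fun p => ∃ q r : MvPolynomial (Fin 2) ℝ,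
    (q = 0 ∨ q.totalDegree + 2 ≤ k) ∧ r.totalDegree ≤ k ∧ p = xvec q + curl r) ?_ ?_ ?_
  · rintro _ _ ⟨q, r, hq, hr, rfl⟩ ⟨q', r', hq', hr', rfl⟩
    refine ⟨q + q', r + r', ?_, (totalDegree_add r r').trans (max_le hr hr'), ?_⟩
    · rcases hq with rfl | hq
      · simpa using hq'
      rcases hq' with rfl | hq'
      · simpa using Or.inr hq
      have := totalDegree_add q q'
      omega
    · rw [xvec_add, curl_add]
      abel
  · exact ⟨0, 0, by simp [xvec, curl, Prod.zero_eq_mk]⟩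
  · exact fun m hm => exists_xvec_add_curl_of_isHomogeneous (Finset.mem_range.mp hm)
      (homogeneousComponent_isHomogeneous m a) (homogeneousComponent_isHomogeneous m b)

/-- The identity `[ℙ_{k−1}]² + curl ℙ_{k+ℓ} = 𝐱 ℙ_{k−2} + curl ℙ_{k+ℓ}` defining the
enhanced projection space `𝒫_{k,ℓ}` (with the convention `ℙ_{−1} = {0}` encoded by the
disjunction on `q`). -/
theorem statement4 (k ℓ : ℕ) (hk : 1 ≤ k) :
    {p : MvPolynomial (Fin 2) ℝ × MvPolynomial (Fin 2) ℝ |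
      ∃ a b r : MvPolynomial (Fin 2) ℝ,
        a.totalDegree ≤ k - 1 ∧ b.totalDegree ≤ k - 1 ∧ r.totalDegree ≤ k + ℓ ∧
        p = (a, b) + curl r} =
    {p : MvPolynomial (Fin 2) ℝ × MvPolynomial (Fin 2) ℝ |
      ∃ q r : MvPolynomial (Fin 2) ℝ,
        (q = 0 ∨ q.totalDegree + 2 ≤ k) ∧ r.totalDegree ≤ k + ℓ ∧
        p = xvec q + curl r} := by
  ext p
  constructor
  · rintro ⟨a, b, r, ha, hb, hr, rfl⟩
    obtain ⟨q, s, hq, hs, h⟩ := exists_xvec_add_curl (k := k) (a := a) (b := b)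
      (by omega) (by omega)
    refine ⟨q, s + r, hq, (totalDegree_add s r).trans (max_le (by omega) hr), ?_⟩
    rw [h, curl_add, add_assoc]
  · rintro ⟨q, r, hq, hr, rfl⟩
    have hX (i : Fin 2) : (X i * q).totalDegree ≤ k - 1 := by
      rcases hq with rfl | hq
      · simp
      have := totalDegree_mul (X i) q
      rw [totalDegree_X] at this
      omega
    exact ⟨X 0 * q, X 1 * q, r, hX 0, hX 1, hr, rfl⟩
end

section
/- Let k ≥ 1 and ℓ ≥ 0. The real vector space 𝒫_{k,ℓ} := {𝐱 q + curl r : q ∈ ℙ_{k−2}, r ∈ ℙ_{k+ℓ}} of polynomial vector fields on ℝ² has dimension k(k−1)/2 + (k+ℓ+1)(k+ℓ+2)/2 − 1. -/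
open MvPolynomial

/-- The bivariate exponents of total degree at most `m`, listed by total degree and first entry. -/
noncomputable def bivariateExponentEquiv (m : ℕ) :
    {s : Fin 2 →₀ ℕ | (s.sum fun _ e => e) ≤ m} ≃ Σ i : Fin (m + 1), Fin (i + 1) where
  toFun s := ⟨⟨s.1 0 + s.1 1, by
    have h := s.2
    rw [Set.mem_ofPred_eq, Finsupp.sum_fintype _ _ (fun _ => rfl), Fin.sum_univ_two] at h
    omega⟩, ⟨s.1 0, by dsimp only; omega⟩⟩
  invFun p := ⟨Finsupp.equivFunOnFinite.symm ![p.2, p.1 - p.2], by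
    have h₁ := p.1.2
    have h₂ := p.2.2
    rw [Set.mem_ofPred_eq, Finsupp.sum_fintype _ _ (fun _ => rfl), Fin.sum_univ_two]
    simp only [Finsupp.equivFunOnFinite_symm_apply_apply, Matrix.cons_val_zero,
      Matrix.cons_val_one]
    omega⟩
  left_inv s := by
    ext i
    fin_cases i <;> simp
  right_inv p := by
    obtain ⟨⟨i, hi⟩, ⟨j, hj⟩⟩ := p
    have h : j + (i - j) = i := by dsimp only at hj; omega
    simp only [Finsupp.equivFunOnFinite_symm_apply_apply, Matrix.cons_val_zero,
      Matrix.cons_val_one, Sigma.mk.injEq, h, true_and]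
    congr!

theorem finrank_restrictTotalDegree_fin_two (m : ℕ) :
    Module.finrank ℝ (restrictTotalDegree (Fin 2) ℝ m) = (m + 1) * (m + 2) / 2 := by
  have e := Module.finrank_eq_nat_card_basis
    (basisRestrictSupport ℝ {s : Fin 2 →₀ ℕ | (s.sum fun _ e => e) ≤ m})
  rw [restrictTotalDegree, e, Nat.card_congr (bivariateExponentEquiv m), Nat.card_eq_fintype_card,
    Fintype.card_sigma]
  simp only [Fintype.card_fin]
  rw [Fin.sum_univ_eq_sum_range (fun i => i + 1), ← add_zero (∑ i ∈ _, _),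
    ← Finset.sum_range_succ' (fun i => i), Finset.sum_range_id, mul_comm]
  rfl

/-- The linear map `(q, r) ↦ 𝐱 q + curl r`. -/
noncomputable def xvecAddCurl :
    MvPolynomial (Fin 2) ℝ × MvPolynomial (Fin 2) ℝ →ₗ[ℝ]
      MvPolynomial (Fin 2) ℝ × MvPolynomial (Fin 2) ℝ where
  toFun p := xvec p.1 + curl p.2
  map_add' p q := by
    ext1 <;> simp only [xvec, curl, Prod.fst_add, Prod.snd_add, map_add] <;> ring
  map_smul' c p := by
    ext1 <;> simp [xvec, curl]

theorem eq_zero_of_pderiv_X_mul_add_eq_zero {q : MvPolynomial (Fin 2) ℝ}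
    (h : pderiv 0 (X 0 * q) + pderiv 1 (X 1 * q) = 0) : q = 0 := by
  ext m
  have hm := congrArg (coeff m) h
  rw [coeff_add, coeff_pderiv, coeff_pderiv, add_comm m, add_comm m, coeff_X_mul, coeff_X_mul,
    ← mul_add, coeff_zero] at hm
  exact (mul_eq_zero.mp hm).resolve_right (by positivity)

theorem eq_C_of_forall_pderiv_eq_zero {σ : Type*} {r : MvPolynomial σ ℝ}
    (h : ∀ i, pderiv i r = 0) : r = C (coeff 0 r) := by
  classical
  ext m
  rw [coeff_C]
  split_ifs with hm
  · rw [hm]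
  · obtain ⟨i, hi⟩ := Finsupp.ne_iff.mp (Ne.symm hm)
    have hr := congrArg (coeff (m - Finsupp.single i 1)) (h i)
    rw [coeff_pderiv, Finsupp.sub_add_single_one_cancel hi, coeff_zero] at hr
    exact (mul_eq_zero.mp hr).resolve_right (by positivity)

theorem pderiv_comm_apply {σ : Type*} (i j : σ) (r : MvPolynomial σ ℝ) :
    pderiv i (pderiv j r) = pderiv j (pderiv i r) := by
  classical
  ext m
  simp only [coeff_pderiv, Finsupp.add_apply, Finsupp.single_apply, add_right_comm m]
  obtain rfl | h := eq_or_ne i j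
  · rfl
  · simp only [h, h.symm, if_false, add_zero]
    ring

theorem ker_xvecAddCurl :
    LinearMap.ker xvecAddCurl = Submodule.span ℝ {(0, 1)} := by
  ext ⟨q, r⟩
  rw [LinearMap.mem_ker, Submodule.mem_span_singleton]
  constructor
  · intro h
    have h₀ : X 0 * q + pderiv 1 r = 0 := congrArg Prod.fst h
    have h₁ : X 1 * q + -pderiv 0 r = 0 := congrArg Prod.snd h
    have hq : q = 0 := by
      apply eq_zero_of_pderiv_X_mul_add_eq_zero
      rw [eq_neg_of_add_eq_zero_left h₀, eq_neg_of_add_eq_zero_left h₁, neg_neg, map_neg,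
        pderiv_comm_apply, neg_add_cancel]
    have hr : r = C (coeff 0 r) := by
      apply eq_C_of_forall_pderiv_eq_zero
      intro i
      fin_cases i
      · simpa [hq] using h₁
      · simpa [hq] using h₀
    refine ⟨coeff 0 r, ?_⟩
    rw [hq, Prod.smul_mk, smul_zero, smul_eq_C_mul, mul_one, ← hr]
  · rintro ⟨c, hc⟩
    rw [← hc, map_smul]
    simp [xvecAddCurl, xvec, curl]

/-- For subspaces `Q` and `R` of scalar polynomials with `1 ∈ R`, the only relations between
`𝐱 q` and `curl r` are those coming from constants `r`. -/
theorem finrank_map_xvecAddCurl_add_one (Q R : Submodule ℝ (MvPolynomial (Fin 2) ℝ))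
    [FiniteDimensional ℝ Q] [FiniteDimensional ℝ R] (hR : 1 ∈ R) :
    Module.finrank ℝ ((Q.prod R).map xvecAddCurl) + 1 =
      Module.finrank ℝ Q + Module.finrank ℝ R := by
  have e : Q.prod R ≃ₗ[ℝ] Q × R :=
    { toFun := fun p => (⟨p.1.1, p.2.1⟩, ⟨p.1.2, p.2.2⟩)
      invFun := fun p => ⟨(p.1, p.2), p.1.2, p.2.2⟩
      map_add' := fun _ _ => rfl
      map_smul' := fun _ _ => rfl }
  have : FiniteDimensional ℝ (Q.prod R) := Module.Finite.equiv e.symm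
  have h := (xvecAddCurl.domRestrict (Q.prod R)).finrank_range_add_finrank_ker
  have hle : LinearMap.ker xvecAddCurl ≤ Q.prod R := by
    rw [ker_xvecAddCurl, Submodule.span_singleton_le_iff_mem]
    exact ⟨Q.zero_mem, hR⟩
  rw [LinearMap.range_domRestrict, LinearMap.ker_domRestrict,
    (Submodule.comapSubtypeEquivOfLe hle).finrank_eq, ker_xvecAddCurl,
    finrank_span_singleton (by simp), e.finrank_eq, Module.finrank_prod] at h
  exact h

/-- The space `𝒫_{k,ℓ} = {𝐱 q + curl r : q ∈ ℙ_{k−2}, r ∈ ℙ_{k+ℓ}}` (a linear subspace,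
here realized as the span of the corresponding set, with the convention `ℙ_{−1} = {0}`
encoded by the disjunction on `q`) has dimension
`k(k−1)/2 + (k+ℓ+1)(k+ℓ+2)/2 − 1`. -/
theorem statement5 (k ℓ : ℕ) (hk : 1 ≤ k) :
    Module.finrank ℝ (Submodule.span ℝ
      {p : MvPolynomial (Fin 2) ℝ × MvPolynomial (Fin 2) ℝ |
        ∃ q r : MvPolynomial (Fin 2) ℝ,
          (q = 0 ∨ q.totalDegree + 2 ≤ k) ∧ r.totalDegree ≤ k + ℓ ∧
          p = xvec q + curl r}) =
    k * (k - 1) / 2 + (k + ℓ + 1) * (k + ℓ + 2) / 2 - 1 := by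
  have hspan (Q : Submodule ℝ (MvPolynomial (Fin 2) ℝ))
      (hQ : ∀ q, q ∈ Q ↔ q = 0 ∨ q.totalDegree + 2 ≤ k) :
      {p : MvPolynomial (Fin 2) ℝ × MvPolynomial (Fin 2) ℝ |
        ∃ q r : MvPolynomial (Fin 2) ℝ,
          (q = 0 ∨ q.totalDegree + 2 ≤ k) ∧ r.totalDegree ≤ k + ℓ ∧
          p = xvec q + curl r} =
      (Q.prod (restrictTotalDegree (Fin 2) ℝ (k + ℓ))).map xvecAddCurl := by
    ext p
    simp [hQ, mem_restrictTotalDegree, xvecAddCurl, eq_comm, and_assoc]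
  have hone : (1 : MvPolynomial (Fin 2) ℝ) ∈ restrictTotalDegree (Fin 2) ℝ (k + ℓ) := by
    simp [mem_restrictTotalDegree]
  have hR := finrank_restrictTotalDegree_fin_two (k + ℓ)
  obtain rfl | ⟨j, rfl⟩ : k = 1 ∨ ∃ j, k = j + 2 := by
    obtain _ | _ | j := k
    · omega
    · exact .inl rfl
    · exact .inr ⟨j, rfl⟩
  · rw [hspan ⊥ (by simp), Submodule.span_eq]
    have h := finrank_map_xvecAddCurl_add_one ⊥ _ hone
    rw [hR, finrank_bot] at h
    simp only [Nat.sub_self, mul_zero, Nat.zero_div]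
    omega
  · rw [hspan (restrictTotalDegree (Fin 2) ℝ j) fun q => by
      rw [mem_restrictTotalDegree]
      constructor
      · intro h
        exact .inr (by omega)
      · rintro (rfl | h)
        · simp
        · omega, Submodule.span_eq]
    have h := finrank_map_xvecAddCurl_add_one (restrictTotalDegree (Fin 2) ℝ j) _ hone
    rw [hR, finrank_restrictTotalDegree_fin_two] at h
    rw [show j + 2 - 1 = j + 1 by omega, mul_comm (j + 2)]
    omega
end
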